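/- arXiv:2405.17847 — 2 statements merged into one kernel-verified Lean document; each statement's English description precedes it below -/
import Mathlib

section
/- Let k ≥ 2 and let T be a k-regular tree with covariance matrix C and Haar-like matrix Φ. Let u, v ∈ I and let ψ_u, ψ_v be Haar-like wavelets associated with u and v respectively. Then (Φ'CΦ)(ψ_u, ψ_v) = ∑_{i ∈ L(u)∩L(v)} ψ_u(i) ℓ*(i,v) ψ_v(i); in particular, (Φ'CΦ)(ψ_u, ψ_v) = 0 whenever L(u) ∩ L(v) = ∅. -/
/-- A finite rooted tree, encoded by a parent function together with a depth
function certifying acyclicity and connectivity to the root. -/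
structure FinRootedTree where
  V : Type
  fintypeV : Fintype V
  decEqV : DecidableEq V
  root : V
  parent : V → V
  parent_root : parent root = root
  depth : V → ℕ
  depth_eq_zero : ∀ v : V, depth v = 0 ↔ v = root
  depth_parent : ∀ v : V, v ≠ root → depth (parent v) + 1 = depth v

attribute [instance] FinRootedTree.fintypeV FinRootedTree.decEqV

namespace FinRootedTree

variable (T : FinRootedTree)

/-- The children of a vertex. -/
def children (v : T.V) : Finset T.V :=
  Finset.univ.filter fun u => u ≠ T.root ∧ T.parent u = v

/-- A vertex is a leaf when it has no children. -/
def IsLeaf (v : T.V) : Prop := T.children v = ∅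

instance : DecidablePred T.IsLeaf := fun v =>
  decidable_of_iff (T.children v = ∅) Iff.rfl

/-- The set of leaves. -/
def leaves : Finset T.V := Finset.univ.filter fun v => T.IsLeaf v

/-- The set of interior nodes. -/
def interior : Finset T.V := Finset.univ.filter fun v => ¬ T.IsLeaf v

/-- The ancestors of `v`, including `v` itself. -/
def ancSelf (v : T.V) : Finset T.V :=
  (Finset.range (Fintype.card T.V + 1)).image (fun m => T.parent^[m] v)

/-- The edges on the path from `v` to the root; each edge is identified with
its endpoint farther from the root. -/
def edgesToRoot (v : T.V) : Finset T.V := (T.ancSelf v).erase T.root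

/-- The edges on the path between `u` and `v`. -/
def pathEdges (u v : T.V) : Finset T.V :=
  (T.edgesToRoot u \ T.edgesToRoot v) ∪ (T.edgesToRoot v \ T.edgesToRoot u)

/-- The leaves of the subtree rooted at `v`. -/
def leavesBelow (v : T.V) : Finset T.V := T.leaves.filter fun i => v ∈ T.ancSelf i

/-- The phylogenetic covariance matrix: `cov ℓ i j = ∑_{e ∈ [i∧j, ∘]} ℓ(e)`
(the edges from the least common ancestor of `i` and `j` to the root are
exactly the common ancestors of `i` and `j` other than the root). -/
def cov (ℓ : T.V → ℝ) (i j : T.V) : ℝ :=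
  ∑ w ∈ T.edgesToRoot i ∩ T.edgesToRoot j, ℓ w

/-- The trace length `ℓ*(u,v) = ∑_{e ∈ [u,v]} |L(e)| ℓ(e)`. -/
def traceLength (ℓ : T.V → ℝ) (u v : T.V) : ℝ :=
  ∑ w ∈ T.pathEdges u v, ((T.leavesBelow w).card : ℝ) * ℓ w

/-- Internal path length: the sum of the depths of the interior nodes. -/
def IPL : ℕ := ∑ v ∈ T.interior, T.depth v

/-- `T` is `k`-regular: the root has exactly one child and every other
interior node has exactly `k` children. -/
def IsKRegular (k : ℕ) : Prop :=
  (T.children T.root).card = 1 ∧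
    ∀ v : T.V, v ≠ T.root → ¬ T.IsLeaf v → (T.children v).card = k

end FinRootedTree

/-- A `k`-regular structure on a finite rooted tree: an ordering of the
children of each interior non-root node by `{0, …, k-1}` (index `i`
corresponds to the child `v_{i+1}` of the paper), the root having degree
one. -/
structure KRegStruct (k : ℕ) (T : FinRootedTree) where
  child : T.V → ℕ → T.V
  root_deg : (T.children T.root).card = 1
  child_mem : ∀ v : T.V, v ≠ T.root → ¬ T.IsLeaf v → ∀ i < k, child v i ∈ T.children v
  child_inj : ∀ v : T.V, v ≠ T.root → ¬ T.IsLeaf v →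
      ∀ i < k, ∀ j < k, child v i = child v j → i = j
  child_surj : ∀ v : T.V, v ≠ T.root → ¬ T.IsLeaf v →
      ∀ u ∈ T.children v, ∃ i < k, child v i = u

/-- The mother wavelet `φ_∘` of a tree. -/
noncomputable def FinRootedTree.rootWavelet (T : FinRootedTree) : T.V → ℝ :=
  fun _ => 1 / Real.sqrt ((T.leaves.card : ℝ))

/-- The index set of the Haar-like wavelets: the root index `none` together
with the pairs `(v, n)` for `v` an interior non-root node and `1 ≤ n < k`. -/
def FinRootedTree.waveletIdx (k : ℕ) (T : FinRootedTree) : Finset (Option (T.V × ℕ)) :=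
  insert none (((T.interior.erase T.root) ×ˢ Finset.Ico 1 k).image some)

namespace KRegStruct

variable {k : ℕ} {T : FinRootedTree} (R : KRegStruct k T)

/-- `L_{v,n}`: the leaves below the first `n` children of `v`. -/
def Lpart (v : T.V) (n : ℕ) : Finset T.V :=
  (Finset.range n).biUnion fun j => T.leavesBelow (R.child v j)

/-- `L(v_{n+1})`: the leaves below the `(n+1)`-st child of `v`. -/
def Lnext (v : T.V) (n : ℕ) : Finset T.V := T.leavesBelow (R.child v n)

/-- The Haar-like wavelet `φ_{v,n}`. -/
noncomputable def wavelet (v : T.V) (n : ℕ) : T.V → ℝ := fun i =>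
  if i ∈ R.Lpart v n then
    Real.sqrt (((R.Lnext v n).card : ℝ) /
      (((R.Lpart v n).card : ℝ) * (((R.Lpart v n ∪ R.Lnext v n)).card : ℝ)))
  else if i ∈ R.Lnext v n then
    - Real.sqrt (((R.Lpart v n).card : ℝ) /
      (((R.Lnext v n).card : ℝ) * (((R.Lpart v n ∪ R.Lnext v n)).card : ℝ)))
  else 0

/-- `ψ` is a Haar-like wavelet associated with the node `v`. -/
def IsWaveletAt (v : T.V) (ψ : T.V → ℝ) : Prop :=
  (v = T.root ∧ ψ = T.rootWavelet) ∨
    (v ≠ T.root ∧ ∃ n : ℕ, 1 ≤ n ∧ n < k ∧ ψ = R.wavelet v n)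

/-- The family of all Haar-like wavelets, as indexed above (the columns of the
Haar-like matrix `Φ`). -/
noncomputable def waveFun : Option (T.V × ℕ) → T.V → ℝ
  | none => T.rootWavelet
  | some (v, n) => R.wavelet v n

/-- The entry of `Φ' C Φ` in row `a` and column `b`. -/
noncomputable def entry (ℓ : T.V → ℝ) (a b : Option (T.V × ℕ)) : ℝ :=
  ∑ j ∈ T.leaves, ∑ i ∈ T.leaves, R.waveFun a j * T.cov ℓ j i * R.waveFun b i

open Classical in
/-- `ζ`: the fraction of vanishing entries of the `|L| × |L|` matrix `Φ' C Φ`. -/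
noncomputable def zeta (ℓ : T.V → ℝ) : ℝ :=
  ((((T.waveletIdx k ×ˢ T.waveletIdx k).filter fun p => R.entry ℓ p.1 p.2 = 0).card : ℝ)) /
    ((T.leaves.card : ℝ)) ^ 2

end KRegStruct

namespace FinRootedTree

variable {T : FinRootedTree}

theorem depth_parent_all (v : T.V) : T.depth (T.parent v) = T.depth v - 1 := by
  by_cases h : v = T.root
  · subst h
    rw [T.parent_root, (T.depth_eq_zero _).2 rfl]
  · have := T.depth_parent v h
    omega

theorem depth_iter (m : ℕ) (v : T.V) : T.depth (T.parent^[m] v) = T.depth v - m := by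
  induction m with
  | zero => simp
  | succ m ih => rw [Function.iterate_succ_apply', depth_parent_all, ih]; omega

theorem iter_root (m : ℕ) (v : T.V) (h : T.depth v ≤ m) : T.parent^[m] v = T.root := by
  rw [← T.depth_eq_zero, depth_iter]; omega

theorem depth_lt_card (v : T.V) : T.depth v < Fintype.card T.V := by
  have hinj : Function.Injective (fun m : Fin (T.depth v + 1) => T.parent^[(m : ℕ)] v) := by
    intro a b hab
    have := congrArg T.depth hab
    simp only [depth_iter] at this
    ext
    omega
  have := Fintype.card_le_of_injective _ hinj
  simp only [Fintype.card_fin] at this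
  omega

theorem mem_anc {v w : T.V} : w ∈ T.ancSelf v ↔ ∃ m : ℕ, T.parent^[m] v = w := by
  unfold ancSelf
  simp only [Finset.mem_image, Finset.mem_range]
  constructor
  · rintro ⟨m, -, h⟩
    exact ⟨m, h⟩
  · rintro ⟨m, h⟩
    have hd := depth_lt_card v
    by_cases hm : m < Fintype.card T.V + 1
    · exact ⟨m, hm, h⟩
    · refine ⟨T.depth v, by omega, ?_⟩
      rw [← h, iter_root _ _ le_rfl, iter_root _ _ (by omega)]

theorem anc_self (v : T.V) : v ∈ T.ancSelf v := mem_anc.2 ⟨0, rfl⟩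

theorem anc_root (v : T.V) : T.root ∈ T.ancSelf v := mem_anc.2 ⟨_, iter_root _ v le_rfl⟩

theorem anc_trans {a b c : T.V} (h : a ∈ T.ancSelf b) (h' : b ∈ T.ancSelf c) :
    a ∈ T.ancSelf c := by
  obtain ⟨m, rfl⟩ := mem_anc.1 h
  obtain ⟨n, rfl⟩ := mem_anc.1 h'
  exact mem_anc.2 ⟨m + n, Function.iterate_add_apply _ _ _ _⟩

theorem anc_total {a b i : T.V} (h : a ∈ T.ancSelf i) (h' : b ∈ T.ancSelf i) :
    a ∈ T.ancSelf b ∨ b ∈ T.ancSelf a := by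
  obtain ⟨m, rfl⟩ := mem_anc.1 h
  obtain ⟨n, rfl⟩ := mem_anc.1 h'
  rcases le_total m n with hmn | hmn
  · right
    refine mem_anc.2 ⟨n - m, ?_⟩
    rw [← Function.iterate_add_apply]
    congr 2
    omega
  · left
    refine mem_anc.2 ⟨m - n, ?_⟩
    rw [← Function.iterate_add_apply]
    congr 2
    omega

theorem anc_eq_of_depth {a b : T.V} (h : a ∈ T.ancSelf b) (hd : T.depth b ≤ T.depth a) :
    a = b := by
  obtain ⟨m, rfl⟩ := mem_anc.1 h
  rw [depth_iter] at hd
  rcases Nat.eq_zero_or_pos m with rfl | hm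
  · rfl
  · have h0 : T.depth b = 0 := by omega
    rw [iter_root _ _ (by omega), eq_comm, ← T.depth_eq_zero, h0]

theorem anc_antisymm {a b : T.V} (h : a ∈ T.ancSelf b) (h' : b ∈ T.ancSelf a) : a = b := by
  refine anc_eq_of_depth h ?_
  obtain ⟨m, rfl⟩ := mem_anc.1 h'
  rw [depth_iter]; omega

theorem mem_below {i v : T.V} : i ∈ T.leavesBelow v ↔ i ∈ T.leaves ∧ v ∈ T.ancSelf i := by
  simp [leavesBelow]

theorem mem_children {c v : T.V} : c ∈ T.children v ↔ c ≠ T.root ∧ T.parent c = v := by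
  simp [children]

theorem child_anc {c v : T.V} (h : c ∈ T.children v) : v ∈ T.ancSelf c :=
  mem_anc.2 ⟨1, (mem_children.1 h).2⟩

theorem children_eq {c d v i : T.V} (hc : c ∈ T.children v) (hd : d ∈ T.children v)
    (hci : c ∈ T.ancSelf i) (hdi : d ∈ T.ancSelf i) : c = d := by
  have h1 := T.depth_parent c (mem_children.1 hc).1
  have h2 := T.depth_parent d (mem_children.1 hd).1
  rw [(mem_children.1 hc).2] at h1
  rw [(mem_children.1 hd).2] at h2
  rcases anc_total hci hdi with h | h
  · exact anc_eq_of_depth h (by omega)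
  · exact (anc_eq_of_depth h (by omega)).symm

theorem exists_child {v w : T.V} (hv : v ≠ T.root) (h : v ∈ T.ancSelf w) (hne : w ≠ v) :
    ∃ c ∈ T.children v, c ∈ T.ancSelf w := by
  obtain ⟨m, hm⟩ := mem_anc.1 h
  cases m with
  | zero => exact absurd hm hne
  | succ m =>
    rw [Function.iterate_succ_apply'] at hm
    refine ⟨T.parent^[m] w, mem_children.2 ⟨fun hr => hv ?_, hm⟩, mem_anc.2 ⟨m, rfl⟩⟩
    rw [← hm, hr, T.parent_root]

theorem leavesBelow_root : T.leavesBelow T.root = T.leaves := by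
  ext i
  simp [mem_below, anc_root]

end FinRootedTree

namespace KRegStruct

open FinRootedTree

variable {k : ℕ} {T : FinRootedTree} (R : KRegStruct k T)

theorem mem_Lpart {v i : T.V} {n : ℕ} :
    i ∈ R.Lpart v n ↔ ∃ j < n, i ∈ T.leavesBelow (R.child v j) := by
  simp [Lpart]

theorem below_of_child {v i : T.V} (hv : v ≠ T.root) (hl : ¬ T.IsLeaf v) {j : ℕ} (hj : j < k)
    (h : i ∈ T.leavesBelow (R.child v j)) : i ∈ T.leavesBelow v := by
  rw [mem_below] at h ⊢
  exact ⟨h.1, anc_trans (child_anc (R.child_mem v hv hl j hj)) h.2⟩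

theorem child_unique {v i : T.V} (hv : v ≠ T.root) (hl : ¬ T.IsLeaf v) {a j : ℕ}
    (ha : a < k) (hj : j < k) (h : R.child v a ∈ T.ancSelf i)
    (h' : i ∈ T.leavesBelow (R.child v j)) : j = a :=
  R.child_inj v hv hl j hj a ha
    (children_eq (R.child_mem v hv hl j hj) (R.child_mem v hv hl a ha) (mem_below.1 h').2 h)

theorem wavelet_supp {v i : T.V} (hv : v ≠ T.root) (hl : ¬ T.IsLeaf v) {n : ℕ} (hn : n < k)
    (hi : i ∉ T.leavesBelow v) : R.wavelet v n i = 0 := by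
  unfold wavelet
  rw [if_neg, if_neg]
  · exact fun h => hi (R.below_of_child hv hl hn h)
  · intro h
    obtain ⟨j, hj, h⟩ := R.mem_Lpart.1 h
    exact hi (R.below_of_child hv hl (hj.trans hn) h)

theorem wavelet_const {v w i j : T.V} (hv : v ≠ T.root) (hl : ¬ T.IsLeaf v) {n : ℕ} (hn : n < k)
    (h : v ∈ T.ancSelf w) (hne : w ≠ v) (hi : i ∈ T.leavesBelow w) (hj : j ∈ T.leavesBelow w) :
    R.wavelet v n i = R.wavelet v n j := by
  obtain ⟨c, hc, hcw⟩ := exists_child hv h hne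
  obtain ⟨a, ha, rfl⟩ := R.child_surj v hv hl c hc
  have key : ∀ i ∈ T.leavesBelow w, ∀ b < k, (i ∈ T.leavesBelow (R.child v b) ↔ b = a) := by
    intro i hi b hb
    rw [mem_below] at hi
    constructor
    · intro h
      exact R.child_unique hv hl ha hb (anc_trans hcw hi.2) h
    · rintro rfl
      exact mem_below.2 ⟨hi.1, anc_trans hcw hi.2⟩
  have keyP : ∀ i ∈ T.leavesBelow w, (i ∈ R.Lpart v n ↔ a < n) := by
    intro i hi
    rw [mem_Lpart]
    constructor
    · rintro ⟨b, hb, h⟩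
      rwa [← (key i hi b (hb.trans hn)).1 h]
    · intro h
      exact ⟨a, h, (key i hi a ha).2 rfl⟩
  have keyN : ∀ i ∈ T.leavesBelow w, (i ∈ R.Lnext v n ↔ n = a) := fun i hi => key i hi n hn
  unfold wavelet
  simp only [keyP i hi, keyP j hj, keyN i hi, keyN j hj]

theorem sqrt_bal (p n s : ℝ) (hp : 0 ≤ p) (hn : 0 ≤ n) (hs : 0 ≤ s) :
    p * √(n / (p * s)) = n * √(p / (n * s)) := by
  have h1 : p * √(n / (p * s)) = √(p * n / s) := by
    rw [← Real.sqrt_sq hp, ← Real.sqrt_mul (sq_nonneg _), Real.sqrt_sq hp]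
    congr 1
    rcases eq_or_ne p 0 with rfl | h0
    · simp
    rcases eq_or_ne s 0 with rfl | h1
    · simp
    field_simp
  have h2 : n * √(p / (n * s)) = √(p * n / s) := by
    rw [← Real.sqrt_sq hn, ← Real.sqrt_mul (sq_nonneg _), Real.sqrt_sq hn]
    congr 1
    rcases eq_or_ne n 0 with rfl | h0
    · simp
    rcases eq_or_ne s 0 with rfl | h1
    · simp
    field_simp
  rw [h1, h2]

theorem wavelet_sum {v w : T.V} (hv : v ≠ T.root) (hl : ¬ T.IsLeaf v) {n : ℕ} (hn : n < k)
    (h : ¬ (v ∈ T.ancSelf w ∧ w ≠ v)) : ∑ i ∈ T.leavesBelow w, R.wavelet v n i = 0 := by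
  by_cases hw : w ∈ T.ancSelf v
  · have hdisj : Disjoint (R.Lpart v n) (R.Lnext v n) := by
      rw [Finset.disjoint_left]
      intro i hi hi'
      obtain ⟨j, hj, hi⟩ := R.mem_Lpart.1 hi
      have := R.child_unique hv hl hn (hj.trans hn) (mem_below.1 hi').2 hi
      omega
    have hsub : R.Lpart v n ∪ R.Lnext v n ⊆ T.leavesBelow w := by
      intro i hi
      have : i ∈ T.leavesBelow v := by
        rcases Finset.mem_union.1 hi with hi | hi
        · obtain ⟨j, hj, hi⟩ := R.mem_Lpart.1 hi
          exact R.below_of_child hv hl (hj.trans hn) hi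
        · exact R.below_of_child hv hl hn hi
      rw [mem_below] at this ⊢
      exact ⟨this.1, anc_trans hw this.2⟩
    rw [← Finset.sum_subset hsub, Finset.sum_union hdisj]
    · have e1 : ∀ i ∈ R.Lpart v n, R.wavelet v n i = √(((R.Lnext v n).card : ℝ) /
          (((R.Lpart v n).card : ℝ) * (((R.Lpart v n ∪ R.Lnext v n)).card : ℝ))) := by
        intro i hi
        unfold wavelet
        rw [if_pos hi]
      have e2 : ∀ i ∈ R.Lnext v n, R.wavelet v n i = - √(((R.Lpart v n).card : ℝ) /
          (((R.Lnext v n).card : ℝ) * (((R.Lpart v n ∪ R.Lnext v n)).card : ℝ))) := by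
        intro i hi
        unfold wavelet
        rw [if_neg (Finset.disjoint_right.1 hdisj hi), if_pos hi]
      rw [Finset.sum_congr rfl e1, Finset.sum_congr rfl e2, Finset.sum_const, Finset.sum_const,
        nsmul_eq_mul, nsmul_eq_mul, mul_neg,
        sqrt_bal _ _ _ (Nat.cast_nonneg _) (Nat.cast_nonneg _) (Nat.cast_nonneg _)]
      ring
    · intro i _ hi
      rw [Finset.mem_union, not_or] at hi
      unfold wavelet
      rw [if_neg hi.1, if_neg hi.2]
  · refine Finset.sum_eq_zero fun i hi => R.wavelet_supp hv hl hn fun hi' => ?_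
    rcases anc_total (mem_below.1 hi).2 (mem_below.1 hi').2 with h1 | h1
    · exact hw h1
    · refine h ⟨h1, ?_⟩
      rintro rfl
      exact hw h1

/-- The three properties of wavelets which are used. -/
theorem wave_props {v : T.V} (hv : v ∈ T.interior) {ψ : T.V → ℝ} (hψ : R.IsWaveletAt v ψ) :
    (∀ i ∈ T.leaves, i ∉ T.leavesBelow v → ψ i = 0) ∧
    (∀ w, v ∈ T.ancSelf w → w ≠ v → ∀ i ∈ T.leavesBelow w, ∀ j ∈ T.leavesBelow w, ψ i = ψ j) ∧
    (∀ w, w ≠ T.root → ¬ (v ∈ T.ancSelf w ∧ w ≠ v) → ∑ i ∈ T.leavesBelow w, ψ i = 0) := by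
  have hl : ¬ T.IsLeaf v := by
    simpa [FinRootedTree.interior] using hv
  rcases hψ with ⟨rfl, rfl⟩ | ⟨hr, n, -, hn, rfl⟩
  · refine ⟨fun i hi h => ?_, fun _ _ _ _ _ _ _ => rfl, fun w hw h => ?_⟩
    · rw [leavesBelow_root] at h
      exact absurd hi h
    · exact absurd ⟨anc_root w, hw⟩ h
  · exact ⟨fun i _ h => R.wavelet_supp hr hl hn h,
      fun w h hne i hi j hj => R.wavelet_const hr hl hn h hne hi hj,
      fun w _ h => R.wavelet_sum hr hl hn h⟩

end KRegStruct

namespace FinRootedTree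

variable {T : FinRootedTree}

theorem cov_eq (ℓ : T.V → ℝ) (i j : T.V) : T.cov ℓ i j =
    ∑ w ∈ Finset.univ.erase T.root, ℓ w *
      ((if w ∈ T.ancSelf i then 1 else 0) * (if w ∈ T.ancSelf j then 1 else 0)) := by
  have : T.edgesToRoot i ∩ T.edgesToRoot j =
      (Finset.univ.erase T.root).filter fun w => w ∈ T.ancSelf i ∧ w ∈ T.ancSelf j := by
    ext w
    simp only [edgesToRoot, Finset.mem_inter, Finset.mem_erase, Finset.mem_filter,
      Finset.mem_univ]
    tauto
  rw [cov, this, Finset.sum_filter]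
  refine Finset.sum_congr rfl fun w _ => ?_
  by_cases h1 : w ∈ T.ancSelf i <;> by_cases h2 : w ∈ T.ancSelf j <;> simp [h1, h2]

theorem trace_eq (ℓ : T.V → ℝ) (i v : T.V) (hi : v ∈ T.ancSelf i) : T.traceLength ℓ i v =
    ∑ w ∈ Finset.univ.erase T.root, ℓ w * ((if v ∈ T.ancSelf w ∧ w ≠ v then
      ((T.leavesBelow w).card : ℝ) else 0) * (if w ∈ T.ancSelf i then 1 else 0)) := by
  have : T.pathEdges i v =
      (Finset.univ.erase T.root).filter fun w => (v ∈ T.ancSelf w ∧ w ≠ v) ∧ w ∈ T.ancSelf i := by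
    ext w
    simp only [pathEdges, edgesToRoot, Finset.mem_union, Finset.mem_sdiff, Finset.mem_erase,
      Finset.mem_filter, Finset.mem_univ]
    constructor
    · rintro (⟨⟨h1, h2⟩, h3⟩ | ⟨⟨h1, h2⟩, h3⟩)
      · have h4 : w ∉ T.ancSelf v := fun h => h3 ⟨h1, h⟩
        refine ⟨⟨h1, trivial⟩, ⟨(anc_total hi h2).resolve_right h4, ?_⟩, h2⟩
        rintro rfl
        exact h4 (anc_self _)
      · exact absurd ⟨h1, anc_trans h2 hi⟩ h3
    · rintro ⟨⟨h1, -⟩, ⟨h2, h3⟩, h4⟩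
      exact Or.inl ⟨⟨h1, h4⟩, fun h => h3 (anc_antisymm h.2 h2)⟩
  rw [traceLength, this, Finset.sum_filter]
  refine Finset.sum_congr rfl fun w _ => ?_
  by_cases h1 : (v ∈ T.ancSelf w ∧ w ≠ v) <;> by_cases h2 : w ∈ T.ancSelf i <;>
    simp [h1, h2, mul_comm]

theorem sum_ind (f : T.V → ℝ) (w : T.V) :
    ∑ i ∈ T.leaves, (if w ∈ T.ancSelf i then 1 else 0) * f i = ∑ i ∈ T.leavesBelow w, f i := by
  rw [leavesBelow, Finset.sum_filter]
  refine Finset.sum_congr rfl fun i _ => ?_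
  split_ifs <;> simp

theorem main_aux (ℓ : T.V → ℝ) (u v : T.V) (f g : T.V → ℝ)
    (hf : ∀ i ∈ T.leaves, i ∉ T.leavesBelow u → f i = 0)
    (hg : ∀ i ∈ T.leaves, i ∉ T.leavesBelow v → g i = 0)
    (hc : ∀ w, v ∈ T.ancSelf w → w ≠ v →
      ∀ i ∈ T.leavesBelow w, ∀ j ∈ T.leavesBelow w, g i = g j)
    (hs : ∀ w, w ≠ T.root → ¬ (v ∈ T.ancSelf w ∧ w ≠ v) → ∑ i ∈ T.leavesBelow w, g i = 0) :
    ∑ j ∈ T.leaves, ∑ i ∈ T.leaves, f j * T.cov ℓ j i * g i =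
      ∑ i ∈ T.leavesBelow u ∩ T.leavesBelow v, f i * T.traceLength ℓ i v * g i := by
  have hL : ∑ j ∈ T.leaves, ∑ i ∈ T.leaves, f j * T.cov ℓ j i * g i =
      ∑ w ∈ Finset.univ.erase T.root, ℓ w *
        ((∑ j ∈ T.leavesBelow w, f j) * ∑ i ∈ T.leavesBelow w, g i) := by
    have e : ∀ w, ℓ w * ((∑ j ∈ T.leavesBelow w, f j) * ∑ i ∈ T.leavesBelow w, g i) =
        ∑ j ∈ T.leaves, ∑ i ∈ T.leaves, f j * (ℓ w * ((if w ∈ T.ancSelf j then 1 else 0) *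
          (if w ∈ T.ancSelf i then 1 else 0))) * g i := by
      intro w
      rw [← sum_ind f, ← sum_ind g, Finset.sum_mul_sum, Finset.mul_sum]
      refine Finset.sum_congr rfl fun j _ => ?_
      rw [Finset.mul_sum]
      refine Finset.sum_congr rfl fun i _ => ?_
      ring
    simp only [e]
    rw [Finset.sum_comm (s := Finset.univ.erase T.root)]
    refine Finset.sum_congr rfl fun j _ => ?_
    rw [Finset.sum_comm (s := Finset.univ.erase T.root)]
    refine Finset.sum_congr rfl fun i _ => ?_
    rw [cov_eq, Finset.mul_sum, Finset.sum_mul]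
  have hsub : T.leavesBelow u ∩ T.leavesBelow v ⊆ T.leaves := fun i hi =>
    (mem_below.1 (Finset.mem_inter.1 hi).1).1
  have hR : ∑ i ∈ T.leavesBelow u ∩ T.leavesBelow v, f i * T.traceLength ℓ i v * g i =
      ∑ w ∈ Finset.univ.erase T.root, ℓ w * ((if v ∈ T.ancSelf w ∧ w ≠ v then
        ((T.leavesBelow w).card : ℝ) else 0) * ∑ i ∈ T.leavesBelow w, f i * g i) := by
    have e : ∀ w, ℓ w * ((if v ∈ T.ancSelf w ∧ w ≠ v then
        ((T.leavesBelow w).card : ℝ) else 0) * ∑ i ∈ T.leavesBelow w, f i * g i) =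
        ∑ i ∈ T.leaves, f i * (ℓ w * ((if v ∈ T.ancSelf w ∧ w ≠ v then
        ((T.leavesBelow w).card : ℝ) else 0) * (if w ∈ T.ancSelf i then 1 else 0))) * g i := by
      intro w
      rw [← sum_ind (fun i => f i * g i), Finset.mul_sum, Finset.mul_sum]
      refine Finset.sum_congr rfl fun i _ => ?_
      ring
    simp only [e]
    rw [Finset.sum_comm, ← Finset.sum_subset hsub]
    · refine Finset.sum_congr rfl fun i hi => ?_
      rw [trace_eq ℓ i v (mem_below.1 (Finset.mem_inter.1 hi).2).2, Finset.mul_sum,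
        Finset.sum_mul]
    · intro i hi hn
      refine Finset.sum_eq_zero fun w _ => ?_
      by_cases h : i ∈ T.leavesBelow u
      · rw [hg i hi fun h' => hn (Finset.mem_inter.2 ⟨h, h'⟩), mul_zero]
      · rw [hf i hi h, zero_mul, zero_mul]
  rw [hL, hR]
  refine Finset.sum_congr rfl fun w hw => ?_
  congr 1
  by_cases h : v ∈ T.ancSelf w ∧ w ≠ v
  · rw [if_pos h, Finset.sum_mul, Finset.mul_sum]
    refine Finset.sum_congr rfl fun i hi => ?_
    rw [Finset.sum_congr rfl fun j hj => hc w h.1 h.2 j hj i hi, Finset.sum_const, nsmul_eq_mul]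
    ring
  · rw [if_neg h, hs w (Finset.ne_of_mem_erase hw) h, mul_zero, zero_mul]

end FinRootedTree

/-- For wavelets `ψ_u, ψ_v` associated with interior nodes
`u, v`, the `(ψ_u, ψ_v)` entry of `Φ' C Φ` equals
`∑_{i ∈ L(u) ∩ L(v)} ψ_u(i) ℓ*(i,v) ψ_v(i)`; in particular it vanishes when
`L(u) ∩ L(v) = ∅`. -/
theorem entry_eq_sum_inter (k : ℕ) (hk : 2 ≤ k) (T : FinRootedTree)
    (R : KRegStruct k T) (ℓ : T.V → ℝ) (hℓ : ∀ w : T.V, w ≠ T.root → 0 < ℓ w)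
    (u v : T.V) (hu : u ∈ T.interior) (hv : v ∈ T.interior)
    (ψu ψv : T.V → ℝ) (hψu : R.IsWaveletAt u ψu) (hψv : R.IsWaveletAt v ψv) :
    (∑ j ∈ T.leaves, ∑ i ∈ T.leaves, ψu j * T.cov ℓ j i * ψv i =
        ∑ i ∈ T.leavesBelow u ∩ T.leavesBelow v, ψu i * T.traceLength ℓ i v * ψv i) ∧
      (T.leavesBelow u ∩ T.leavesBelow v = ∅ →
        ∑ j ∈ T.leaves, ∑ i ∈ T.leaves, ψu j * T.cov ℓ j i * ψv i = 0) := by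
  obtain ⟨hf, -, -⟩ := R.wave_props hu hψu
  obtain ⟨hg, hc, hs⟩ := R.wave_props hv hψv
  have main := FinRootedTree.main_aux ℓ u v ψu ψv hf hg hc hs
  exact ⟨main, fun h => by rw [main, h, Finset.sum_empty]⟩
end

section
/- Let k ≥ 2, let a_n = (1/((k−1)n+1))·binom(kn, n) be the Fuss–Catalan numbers, let z_k := (k−1)^{k−1}/k^k, and let Q(z_k) := ∑_{n≥0} a_n z_k^n (a convergent series). Then Q(z_k) = k/(k−1); in particular, k·z_k·Q(z_k)^{k−1} = 1. -/
/-- The Fuss–Catalan numbers with parameter `k`, as real numbers: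
`a_n = (1/((k-1)n+1)) · C(kn, n)`. -/
noncomputable def fussCatalanR (k n : ℕ) : ℝ :=
  (Nat.choose (k * n) n : ℝ) / (((k : ℝ) - 1) * (n : ℝ) + 1)

/-- `z_k = (k-1)^{k-1}/k^k`. -/
noncomputable def zk (k : ℕ) : ℝ := ((k : ℝ) - 1) ^ (k - 1) / (k : ℝ) ^ k

open Finset PowerSeries in
/-- Key coefficient identity. -/
lemma fc_coeff_id (j n m : ℕ) (hnm : n ≤ m + 1) :
    ((m : ℝ) + 1) * (fussCatalanR (j + 1) n * ((j * n + 1).choose (m + 1 - n) : ℝ)) =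
      ((m + 1).choose n : ℝ) * (((j + 1) * n).choose m : ℝ) := by
  unfold fussCatalanR
  rcases Nat.lt_or_ge (j * n + 1) (m + 1 - n) with h | h
  · have h2 : (j + 1) * n < m := by
      have : (j + 1) * n = j * n + n := by ring
      omega
    rw [Nat.choose_eq_zero_of_lt h, Nat.choose_eq_zero_of_lt h2]
    simp
  · have e : (j + 1) * n = j * n + n := by ring
    rw [e]
    have hm : m ≤ j * n + n := by omega
    rw [Nat.cast_choose ℝ h, Nat.cast_choose ℝ hnm, Nat.cast_choose ℝ hm,
      Nat.cast_choose ℝ (show n ≤ j * n + n by omega)]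
    have e1 : j * n + n - n = j * n := by omega
    have e2 : j * n + 1 - (m + 1 - n) = j * n + n - m := by omega
    rw [e1, e2, Nat.factorial_succ m, Nat.factorial_succ (j * n)]
    have p1 : ((j : ℝ) * n + 1) ≠ 0 := by positivity
    have f1 : ((n.factorial : ℕ) : ℝ) ≠ 0 := by positivity
    have f2 : ((m.factorial : ℕ) : ℝ) ≠ 0 := by positivity
    have f3 : (((j * n).factorial : ℕ) : ℝ) ≠ 0 := by positivity
    have f4 : (((m + 1 - n).factorial : ℕ) : ℝ) ≠ 0 := by positivity
    have f5 : (((j * n + n - m).factorial : ℕ) : ℝ) ≠ 0 := by positivity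
    push_cast
    rw [add_sub_cancel_right]
    field_simp

open Finset in
/-- A finite difference vanishing. -/
lemma fc_alt_sum (k m : ℕ) :
    ∑ n ∈ range (m + 2), (-1 : ℝ) ^ (m + 1 - n) * (((m + 1).choose n : ℝ) * ((k * n).choose m : ℝ))
      = 0 := by
  have h : (Polynomial.X : Polynomial ℝ) ^ (m + 1) ∣ ((1 + Polynomial.X) ^ k + (-1)) ^ (m + 1) := by
    apply pow_dvd_pow_of_dvd
    rw [Polynomial.X_dvd_iff]
    simp [Polynomial.coeff_zero_eq_eval_zero]
  have h2 := (Polynomial.X_pow_dvd_iff.1 h) m (Nat.lt_succ_self m)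
  rw [add_pow, Polynomial.finsetSum_coeff] at h2
  rw [← h2]
  apply sum_congr rfl
  intro n _
  have e : ((1 + Polynomial.X : Polynomial ℝ) ^ k) ^ n * (-1) ^ (m + 1 - n) * ((m + 1).choose n : Polynomial ℝ)
     = Polynomial.C ((-1 : ℝ) ^ (m + 1 - n) * ((m + 1).choose n : ℝ)) * (1 + Polynomial.X) ^ (k * n) := by
    rw [pow_mul]
    simp
    ring
  rw [e, Polynomial.coeff_C_mul, Polynomial.coeff_one_add_X_pow]
  ring

lemma fc_coeff_pow (N d : ℕ) :
    PowerSeries.coeff d ((1 - PowerSeries.X : PowerSeries ℝ) ^ N) = (-1) ^ d * (N.choose d : ℝ) := by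
  have h : ((1 - PowerSeries.X : PowerSeries ℝ) ^ N) =
      PowerSeries.rescale (-1 : ℝ) (((1 + Polynomial.X : Polynomial ℝ) ^ N : Polynomial ℝ) : PowerSeries ℝ) := by
    simp [PowerSeries.rescale_X, sub_eq_add_neg]
  rw [h, PowerSeries.coeff_rescale, Polynomial.coeff_coe, Polynomial.coeff_one_add_X_pow]

noncomputable def fcA (j : ℕ) : PowerSeries ℝ := PowerSeries.mk (fussCatalanR (j + 1))

noncomputable def fcW (j : ℕ) : PowerSeries ℝ := PowerSeries.X * (1 - PowerSeries.X) ^ j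

lemma fcW_const (j : ℕ) : PowerSeries.constantCoeff (fcW j) = 0 := by simp [fcW]

lemma fcW_hasSubst (j : ℕ) : PowerSeries.HasSubst (fcW j) :=
  PowerSeries.HasSubst.of_constantCoeff_zero' (fcW_const j)

open Finset in
lemma fc_subst (j : ℕ) : (fcA j).subst (fcW j) * (1 - PowerSeries.X) = 1 := by
  have key : ∀ m e : ℕ, e ≤ m → PowerSeries.coeff e ((fcA j).subst (fcW j)) =
      PowerSeries.coeff e (∑ n ∈ range (m + 1), PowerSeries.C (fussCatalanR (j + 1) n) * fcW j ^ n) := by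
    intro m e he
    rw [PowerSeries.coeff_subst' (fcW_hasSubst j), map_sum]
    rw [finsum_eq_sum_of_support_subset (s := range (m + 1))]
    · apply sum_congr rfl
      intro n _
      simp [fcA]
    · intro d hd
      simp only [Finset.coe_range, Set.mem_Iio]
      by_contra hlt
      apply hd
      have : PowerSeries.coeff e (fcW j ^ d) = 0 := by
        rw [fcW, mul_pow]
        rw [PowerSeries.coeff_X_pow_mul']
        rw [if_neg (by omega)]
      simp [this]
  have key2 : ∀ m : ℕ, PowerSeries.coeff m ((fcA j).subst (fcW j) * (1 - PowerSeries.X)) =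
      ∑ n ∈ range (m + 1), fussCatalanR (j + 1) n * ((-1) ^ (m - n) * ((j * n + 1).choose (m - n) : ℝ)) := by
    intro m
    have : PowerSeries.coeff m ((fcA j).subst (fcW j) * (1 - PowerSeries.X)) =
      PowerSeries.coeff m ((∑ n ∈ range (m + 1), PowerSeries.C (fussCatalanR (j + 1) n) * fcW j ^ n) * (1 - PowerSeries.X)) := by
      rw [PowerSeries.coeff_mul, PowerSeries.coeff_mul]
      apply sum_congr rfl
      intro p hp
      rw [key m p.1 (by have := mem_antidiagonal.1 hp; omega)]
    rw [this, sum_mul, map_sum]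
    apply sum_congr rfl
    intro n hn
    have hn' : n ≤ m := by have := mem_range.1 hn; omega
    have e : PowerSeries.C (fussCatalanR (j + 1) n) * fcW j ^ n * (1 - PowerSeries.X) =
      PowerSeries.C (fussCatalanR (j + 1) n) * (PowerSeries.X ^ n * (1 - PowerSeries.X) ^ (j * n + 1)) := by
      rw [fcW, mul_pow, pow_succ, pow_mul]; ring
    rw [e, PowerSeries.coeff_C_mul, PowerSeries.coeff_X_pow_mul', if_pos hn', fc_coeff_pow]
  ext m
  rw [key2]
  cases m with
  | zero => simp [fussCatalanR]
  | succ m =>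
    rw [PowerSeries.coeff_one, if_neg (by omega)]
    have h0 := fc_alt_sum (j + 1) m
    have hm : ((m : ℝ) + 1) ≠ 0 := by positivity
    apply mul_left_cancel₀ hm
    rw [mul_zero, ← h0, mul_sum]
    apply sum_congr rfl
    intro n hn
    rw [← fc_coeff_id j n m (by have := mem_range.1 hn; omega)]
    ring

lemma fc_subst_inj (j : ℕ) (f : PowerSeries ℝ) (h : f.subst (fcW j) = 0) : f = 0 := by
  have hu : IsUnit ((fcW j).coeff 1) := by
    have h := PowerSeries.coeff_succ_X_mul 0 ((1 - PowerSeries.X : PowerSeries ℝ) ^ j)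
    rw [zero_add, fc_coeff_pow] at h
    rw [fcW, h]
    simp
  have hs := PowerSeries.subst_substInvOfIsUnit_right (fcW j) (fcW_const j) hu
  have hS : PowerSeries.HasSubst (PowerSeries.substInvOfIsUnit (fcW j) hu) :=
    PowerSeries.HasSubst.substInvOfIsUnit (fcW j) hu
  have h2 := PowerSeries.subst_comp_subst_apply (fcW_hasSubst j) hS f
  rw [hs, PowerSeries.X_subst, h] at h2
  rw [← h2, ← PowerSeries.coe_substAlgHom hS, map_zero]

lemma fc_functional (j : ℕ) : fcA j = 1 + PowerSeries.X * fcA j ^ (j + 1) := by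
  rw [← sub_eq_zero]
  apply fc_subst_inj j
  have hW := fcW_hasSubst j
  have h := fc_subst j
  rw [← PowerSeries.coe_substAlgHom hW] at h ⊢
  rw [map_sub, map_add, map_mul, map_pow, map_one, PowerSeries.substAlgHom_X]
  set B := (PowerSeries.substAlgHom hW) (fcA j)
  have h3 : fcW j * B ^ (j + 1) = PowerSeries.X * B * (B * (1 - PowerSeries.X)) ^ j := by
    rw [fcW, pow_succ, mul_pow]; ring
  rw [h3, h, one_pow, mul_one]
  linear_combination h

lemma fc_nonneg (j n : ℕ) : 0 ≤ fussCatalanR (j + 1) n := by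
  unfold fussCatalanR
  push_cast
  rw [add_sub_cancel_right]
  positivity

open Finset in
/-- Nonnegativity and truncated sum bound of powers. -/
lemma fc_pow_bound (F : PowerSeries ℝ) (hF : ∀ n, 0 ≤ PowerSeries.coeff n F) (z : ℝ) (hz : 0 ≤ z)
    (N k : ℕ) : (∀ n, 0 ≤ PowerSeries.coeff n (F ^ k)) ∧
    ∑ n ∈ range N, PowerSeries.coeff n (F ^ k) * z ^ n ≤
      (∑ n ∈ range N, PowerSeries.coeff n F * z ^ n) ^ k := by
  induction k with
  | zero =>
    constructor
    · intro n
      rw [pow_zero, PowerSeries.coeff_one]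
      split_ifs <;> norm_num
    · simp only [pow_zero, PowerSeries.coeff_one, ite_mul, one_mul, zero_mul]
      rw [Finset.sum_ite_eq']
      split_ifs <;> norm_num
  | succ k ih =>
    obtain ⟨h1, h2⟩ := ih
    constructor
    · intro n
      rw [pow_succ, PowerSeries.coeff_mul]
      exact sum_nonneg fun p _ => mul_nonneg (h1 _) (hF _)
    · have hS : 0 ≤ ∑ n ∈ range N, PowerSeries.coeff n F * z ^ n :=
        sum_nonneg fun n _ => mul_nonneg (hF n) (pow_nonneg hz n)
      rw [pow_succ (∑ n ∈ range N, PowerSeries.coeff n F * z ^ n)]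
      refine le_trans ?_ (mul_le_mul_of_nonneg_right h2 hS)
      rw [sum_mul_sum, ← sum_product']
      have e : ∀ n ∈ range N, PowerSeries.coeff n (F ^ (k + 1)) * z ^ n =
          ∑ p ∈ antidiagonal n, PowerSeries.coeff p.1 (F ^ k) * z ^ p.1 *
            (PowerSeries.coeff p.2 F * z ^ p.2) := by
        intro n _
        rw [pow_succ, PowerSeries.coeff_mul, sum_mul]
        apply sum_congr rfl
        intro p hp
        rw [← mem_antidiagonal.1 hp, pow_add]
        ring
      rw [sum_congr rfl e, ← sum_biUnion]
      · apply sum_le_sum_of_subset_of_nonneg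
        · intro p hp
          simp only [mem_biUnion, mem_range, HasAntidiagonal.mem_antidiagonal, mem_product] at hp ⊢
          obtain ⟨a, ha, hb⟩ := hp
          omega
        · intro p _ _
          exact mul_nonneg (mul_nonneg (h1 _) (pow_nonneg hz _)) (mul_nonneg (hF _) (pow_nonneg hz _))
      · intro a _ b _ hab
        rw [Function.onFun, Finset.disjoint_left]
        intro p hp hq
        exact hab ((mem_antidiagonal.1 hp).symm.trans (mem_antidiagonal.1 hq))

open Finset in
lemma fc_hasSum_pow (F : PowerSeries ℝ) (hF : ∀ n, 0 ≤ PowerSeries.coeff n F) (z : ℝ) (hz : 0 ≤ z)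
    (Q : ℝ) (hQ : HasSum (fun n => PowerSeries.coeff n F * z ^ n) Q) (k : ℕ) :
    HasSum (fun n => PowerSeries.coeff n (F ^ k) * z ^ n) (Q ^ k) := by
  induction k with
  | zero =>
    have := hasSum_single (f := fun n => PowerSeries.coeff n (F ^ 0) * z ^ n) 0 (by
      intro n hn
      simp [PowerSeries.coeff_one, hn])
    simpa using this
  | succ k ih =>
    have nn : ∀ n, 0 ≤ PowerSeries.coeff n (F ^ k) * z ^ n := fun n =>
      mul_nonneg ((fc_pow_bound F hF z hz 0 k).1 n) (pow_nonneg hz n)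
    have nn' : ∀ n, 0 ≤ PowerSeries.coeff n F * z ^ n := fun n =>
      mul_nonneg (hF n) (pow_nonneg hz n)
    have s1 : Summable fun n => ‖PowerSeries.coeff n (F ^ k) * z ^ n‖ := ih.summable.norm
    have s2 : Summable fun n => ‖PowerSeries.coeff n F * z ^ n‖ := hQ.summable.norm
    have hs := (summable_norm_sum_mul_antidiagonal_of_summable_norm s1 s2).of_norm.hasSum
    rw [← tsum_mul_tsum_eq_tsum_sum_antidiagonal_of_summable_norm s1 s2, ih.tsum_eq, hQ.tsum_eq,
      ← pow_succ] at hs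
    refine Eq.mp (congrArg (fun f : ℕ → ℝ => HasSum f (Q ^ (k + 1))) (funext fun n => ?_)) hs
    symm
    rw [pow_succ, PowerSeries.coeff_mul, sum_mul]
    apply sum_congr rfl
    intro p hp
    rw [← mem_antidiagonal.1 hp, pow_add]
    ring

lemma fc_unique (j : ℕ) (hj : 1 ≤ j) (x : ℝ) (hx : 0 ≤ x)
    (h : x = 1 + zk (j + 1) * x ^ (j + 1)) : x = ((j : ℝ) + 1) / j := by
  have hj0 : (0 : ℝ) < j := by exact_mod_cast hj
  obtain ⟨y, hy⟩ : ∃ y, y = x * j / (j + 1) := ⟨_, rfl⟩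
  have hxy : x = y * (j + 1) / j := by rw [hy]; field_simp
  have hy0 : 0 ≤ y := by rw [hy]; positivity
  have hz : zk (j + 1) * x ^ (j + 1) = y ^ (j + 1) / j := by
    rw [hxy, zk]
    push_cast
    rw [add_sub_cancel_right, div_pow, mul_pow, pow_succ (j : ℝ) j]
    field_simp
  rw [hz, hxy] at h
  have h2 : y * (j + 1) = j + y ^ (j + 1) := by
    field_simp at h
    linarith
  have hy1 : y = 1 := by
    by_contra hne
    have hb := one_add_mul_self_lt_rpow_one_add (s := y - 1) (by linarith)
      (sub_ne_zero.2 hne) (p := ((j + 1 : ℕ) : ℝ)) (by push_cast; linarith)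
    rw [Real.rpow_natCast] at hb
    push_cast at hb
    rw [add_sub_cancel] at hb
    nlinarith
  rw [hxy, hy1, one_mul]

lemma fc_fixed (j : ℕ) (hj : 1 ≤ j) :
    1 + zk (j + 1) * (((j : ℝ) + 1) / j) ^ (j + 1) = ((j : ℝ) + 1) / j := by
  have hj0 : (0 : ℝ) < j := by exact_mod_cast hj
  rw [zk]
  push_cast
  rw [add_sub_cancel_right, div_pow, pow_succ (j : ℝ) j]
  field_simp

lemma fc_coeff_succ (j n : ℕ) :
    fussCatalanR (j + 1) (n + 1) = PowerSeries.coeff n (fcA j ^ (j + 1)) := by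
  have h := congrArg (PowerSeries.coeff (n + 1)) (fc_functional j)
  rw [map_add, PowerSeries.coeff_succ_X_mul, PowerSeries.coeff_one, if_neg (by omega), zero_add] at h
  rw [← h, fcA, PowerSeries.coeff_mk]

lemma fc_zero (j : ℕ) : fussCatalanR (j + 1) 0 = 1 := by simp [fussCatalanR]

open Finset in
lemma fc_main (j : ℕ) (hj : 1 ≤ j) :
    HasSum (fun n : ℕ => fussCatalanR (j + 1) n * zk (j + 1) ^ n) (((j : ℝ) + 1) / j) := by
  have hj0 : (0 : ℝ) < j := by exact_mod_cast hj
  have hz : 0 ≤ zk (j + 1) := by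
    unfold zk
    push_cast
    rw [add_sub_cancel_right]
    positivity
  have hA : ∀ n, PowerSeries.coeff n (fcA j) = fussCatalanR (j + 1) n := fun n => by
    rw [fcA, PowerSeries.coeff_mk]
  have hA0 : ∀ n, 0 ≤ PowerSeries.coeff n (fcA j) := fun n => by rw [hA]; exact fc_nonneg j n
  have nn : ∀ n, 0 ≤ fussCatalanR (j + 1) n * zk (j + 1) ^ n := fun n =>
    mul_nonneg (fc_nonneg j n) (pow_nonneg hz n)
  have hb : ∀ N, ∑ n ∈ range N, fussCatalanR (j + 1) n * zk (j + 1) ^ n ≤ ((j : ℝ) + 1) / j := by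
    intro N
    induction N with
    | zero => simp only [range_zero, sum_empty]; positivity
    | succ N ih =>
      rw [sum_range_succ', fc_zero, pow_zero, mul_one, add_comm, ← fc_fixed j hj]
      have e : ∑ n ∈ range N, fussCatalanR (j + 1) (n + 1) * zk (j + 1) ^ (n + 1) =
          zk (j + 1) * ∑ n ∈ range N, PowerSeries.coeff n (fcA j ^ (j + 1)) * zk (j + 1) ^ n := by
        rw [mul_sum]
        apply sum_congr rfl
        intro n _
        rw [fc_coeff_succ, pow_succ]; ring
      rw [e]
      have hp := (fc_pow_bound (fcA j) hA0 (zk (j + 1)) hz N (j + 1)).2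
      simp only [hA] at hp
      have h0 : 0 ≤ ∑ n ∈ range N, fussCatalanR (j + 1) n * zk (j + 1) ^ n :=
        sum_nonneg fun n _ => nn n
      gcongr
      exact hp.trans (pow_le_pow_left₀ h0 ih _)
  have hs : Summable (fun n : ℕ => fussCatalanR (j + 1) n * zk (j + 1) ^ n) :=
    summable_of_sum_range_le nn hb
  have hQ := hs.hasSum
  set Q := ∑' n : ℕ, fussCatalanR (j + 1) n * zk (j + 1) ^ n with hQdef
  have hQ0 : 0 ≤ Q := tsum_nonneg nn
  have hP := fc_hasSum_pow (fcA j) hA0 (zk (j + 1)) hz Q (by simpa only [hA] using hQ) (j + 1)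
  have hP2 := hP.mul_left (zk (j + 1))
  have hQ2 : Q = 1 + zk (j + 1) * Q ^ (j + 1) := by
    have h1 := hs.tsum_eq_zero_add
    rw [← hQdef, fc_zero, pow_zero, mul_one] at h1
    have h2 : ∑' n : ℕ, fussCatalanR (j + 1) (n + 1) * zk (j + 1) ^ (n + 1) =
        zk (j + 1) * Q ^ (j + 1) := by
      rw [← hP2.tsum_eq]
      apply tsum_congr
      intro n
      rw [fc_coeff_succ, pow_succ]; ring
    rw [h2] at h1
    exact h1
  rw [← fc_unique j hj Q hQ0 hQ2]
  exact hQ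

/-- The series `Q(z_k) = ∑ a_n z_k^n` converges, equals
`k/(k-1)`, and in particular `k z_k Q(z_k)^{k-1} = 1`. -/
theorem fussCatalan_value_at_zk (k : ℕ) (hk : 2 ≤ k) :
    Summable (fun n : ℕ => fussCatalanR k n * zk k ^ n) ∧
      (∑' n : ℕ, fussCatalanR k n * zk k ^ n) = (k : ℝ) / ((k : ℝ) - 1) ∧
      (k : ℝ) * zk k * (∑' n : ℕ, fussCatalanR k n * zk k ^ n) ^ (k - 1) = 1 := by
  obtain ⟨j, rfl⟩ : ∃ j, k = j + 1 := ⟨k - 1, by omega⟩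
  have hj : 1 ≤ j := by omega
  have hj0 : (0 : ℝ) < j := by exact_mod_cast hj
  have h := fc_main j hj
  refine ⟨h.summable, ?_, ?_⟩
  · rw [h.tsum_eq]
    push_cast
    rw [add_sub_cancel_right]
  · rw [h.tsum_eq, zk]
    push_cast
    rw [add_sub_cancel_right, div_pow]
    field_simp
    ring
end
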